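/- In the free associative algebra A over a field of characteristic zero, for every odd j ≥ 1 and every k ≥ 1, one has [M_j, L_k] ⊆ L_{j+k}, where M_j is the two-sided ideal generated by L_j. -/

import Mathlib

/-- The commutator `[a,b] = a*b - b*a`. -/
def br {A : Type*} [Ring A] (a b : A) : A := a * b - b * a

/-- Lower central series: `lcs K A 1 = A`, `lcs K A (k+1) = span {[a,l] | a ∈ A, l ∈ lcs K A k}`. -/
def lcs (K : Type*) [Field K] (A : Type*) [Ring A] [Algebra K A] : ℕ → Submodule K A
  | 0 => ⊤
  | 1 => ⊤
  | (k+2) => Submodule.span K {x : A | ∃ a l : A, l ∈ lcs K A (k+1) ∧ x = a * l - l * a}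

/-- `mIdeal K A j = A·L_j·A`, the two-sided ideal generated by `L_j`. -/
def mIdeal (K : Type*) [Field K] (A : Type*) [Ring A] [Algebra K A] (j : ℕ) : Submodule K A :=
  Submodule.span K {x : A | ∃ a l b : A, l ∈ lcs K A j ∧ x = a * l * b}

/-- Triple nested commutator. -/
def t3 {A : Type*} [Ring A] (p q r s : A) : A := br p (br q (br r s))

set_option maxHeartbeats 4000000 in
/-- The key degree five identity. -/
theorem key_identity {A : Type*} [Ring A] (a b c l x : A) :
    (3 : ℤ) • br (a * br b (br c l)) x = t3 (a * b) c x l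
        + t3 (b * c) x a l
        + t3 (b * c) x a l
        + t3 (c * a) b x l
        + t3 (c * a) b x l
        + t3 (c * x) a b l
        + t3 (c * x) a b l
        + t3 (x * a) c b l
        + t3 (x * b) c a l
        + t3 a (b * x) c l
        + t3 a (b * x) c l
        + t3 a (c * b) x l
        + t3 a b c (x * l)
        + t3 b (x * a) c l
        + t3 b a x (c * l)
        + t3 x (c * a) b l
        + t3 x a c (b * l)
        - t3 (a * b) x c l
        - t3 (x * a) b c l
        - t3 (x * a) b c l
        - t3 a (b * c) x l
        - t3 a (b * c) x l
        - t3 a b c (l * x)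
        - t3 a b x (c * l)
        - t3 a c b (x * l)
        - t3 a x c (l * b)
        - t3 b (c * x) a l
        - t3 b a (x * c) l
        - t3 b c x (a * l)
        - t3 b x a (c * l)
        - t3 c a b (x * l)
        - t3 c a b (x * l)
        - t3 c b x (l * a)
        - t3 c b x (l * a)
        - t3 c x a (b * l)
        - t3 c x a (b * l)
        - t3 x (a * c) b l
        - t3 x (a * c) b l
        - t3 x a (b * c) l
        - t3 x b c (a * l)
        - t3 x c a (b * l) := by
  simp only [t3, br, mul_sub, sub_mul, mul_assoc]
  abel

section general
variable {K : Type*} [Field K] {A : Type*} [Ring A] [Algebra K A]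

theorem lcs_br (a : A) {k : ℕ} (hk : 1 ≤ k) {l : A} (hl : l ∈ lcs K A k) :
    br a l ∈ lcs K A (k + 1) := by
  obtain ⟨k, rfl⟩ : ∃ n, k = n + 1 := ⟨k - 1, by omega⟩
  exact Submodule.subset_span ⟨a, l, hl, rfl⟩

theorem br_skew (a b : A) : br a b = - br b a := by simp [br]

theorem lcs_br' (a : A) {k : ℕ} (hk : 1 ≤ k) {l : A} (hl : l ∈ lcs K A k) :
    br l a ∈ lcs K A (k + 1) := by
  rw [br_skew]; exact Submodule.neg_mem _ (lcs_br a hk hl)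

theorem lcs_induct {k : ℕ} (hk : 1 ≤ k) (S : Submodule K A)
    (h : ∀ a : A, ∀ l ∈ lcs K A k, br a l ∈ S) {y : A} (hy : y ∈ lcs K A (k + 1)) : y ∈ S := by
  obtain ⟨k, rfl⟩ : ∃ n, k = n + 1 := ⟨k - 1, by omega⟩
  have : lcs K A (k + 1 + 1) ≤ S := by
    refine Submodule.span_le.2 ?_
    rintro _ ⟨a, l, hl, rfl⟩
    exact h a l hl
  exact this hy

theorem lcs_one (y : A) : y ∈ lcs K A 1 := by simp [lcs]

theorem lcs_anti {k : ℕ} (hk : 1 ≤ k) : lcs K A (k + 1) ≤ lcs K A k := by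
  induction k, hk using Nat.le_induction with
  | base => intro y _; exact lcs_one y
  | succ k hk ih =>
    intro y hy
    exact lcs_induct (by omega) _ (fun a l hl => lcs_br a hk (ih hl)) hy

/-- Commutation with a fixed element on the right, as a linear map. -/
def brR (K : Type*) [Field K] {A : Type*} [Ring A] [Algebra K A] (x : A) : A →ₗ[K] A :=
  LinearMap.mulRight K x - LinearMap.mulLeft K x

theorem brR_apply (x y : A) : brR K x y = br y x := by simp [brR, br]

theorem lcs_lcs {n : ℕ} (hn : 1 ≤ n) : ∀ {m : ℕ}, 1 ≤ m → ∀ {x y : A}, x ∈ lcs K A m →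
    y ∈ lcs K A n → br y x ∈ lcs K A (m + n) := by
  induction n, hn using Nat.le_induction with
  | base => intro m hm x y hx _; exact lcs_br y hm hx
  | succ n hn ih =>
    intro m hm x y hx hy
    have := lcs_induct hn ((lcs K A (m + (n + 1))).comap (brR K x)) (fun a l hl => ?_) hy
    · simpa [brR_apply] using this
    · rw [Submodule.mem_comap, brR_apply]
      have e : br (br a l) x = br a (br l x) - br l (br a x) := by
        simp only [br]; noncomm_ring
      rw [e]
      refine Submodule.sub_mem _ ?_ ?_
      · exact lcs_br a (by omega : 1 ≤ m + n) (ih hm hx hl)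
      · have := ih (m := m + 1) (by omega) (lcs_br a hm hx) hl
        rwa [show m + 1 + n = m + (n + 1) by ring] at this

theorem lcs_step [CharZero K] {j : ℕ} (hj : 1 ≤ j)
    (ih : ∀ a l x : A, l ∈ lcs K A j → br (a * l) x ∈ lcs K A (j + 1))
    (a l x : A) (hl : l ∈ lcs K A (j + 2)) : br (a * l) x ∈ lcs K A (j + 2 + 1) := by
  have comp : ∀ y : A, br (a * y) x = (brR K x ∘ₗ LinearMap.mulLeft K a) y := by
    intro y; simp [brR_apply]
  rw [comp, ← Submodule.mem_comap]
  refine lcs_induct (by omega) _ (fun b y hy => ?_) hl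
  have h2 : y ∈ (lcs K A (j + 2 + 1)).comap
      (brR K x ∘ₗ LinearMap.mulLeft K a ∘ₗ (- brR K b)) := by
    refine lcs_induct hj _ (fun c l hl => ?_) hy
    rw [Submodule.mem_comap]
    have e : (brR K x ∘ₗ LinearMap.mulLeft K a ∘ₗ (- brR K b)) (br c l)
        = br (a * br b (br c l)) x := by
      simp only [LinearMap.comp_apply, LinearMap.neg_apply, brR_apply, LinearMap.mulLeft_apply]
      rw [← br_skew]
    rw [e]
    have h3 : (3 : K) ≠ 0 := by norm_num
    rw [← Submodule.smul_mem_iff _ h3]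
    have e3 : (3 : K) • br (a * br b (br c l)) x = (3 : ℤ) • br (a * br b (br c l)) x := by
      rw [← Int.cast_smul_eq_zsmul K]; norm_num
    rw [e3, key_identity]
    have G : ∀ p q r s : A, br r s ∈ lcs K A (j + 1) → t3 p q r s ∈ lcs K A (j + 2 + 1) :=
      fun p q r s h => lcs_br p (by omega) (lcs_br q (by omega) h)
    have H : ∀ p q r s : A, (∀ z, br s z ∈ lcs K A (j + 1)) → t3 p q r s ∈ lcs K A (j + 2 + 1) :=
      fun p q r s h => G p q r s (by rw [br_skew]; exact Submodule.neg_mem _ (h r))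
    have hL : ∀ u l : A, (∀ z, br l z ∈ lcs K A (j + 1)) ∧ l ∈ lcs K A j →
        ∀ z, br (u * l) z ∈ lcs K A (j + 1) := fun u l h z => ih u l z h.2
    have hR : ∀ u l : A, (∀ z, br l z ∈ lcs K A (j + 1)) ∧ l ∈ lcs K A j →
        ∀ z, br (l * u) z ∈ lcs K A (j + 1) := fun u l h z => by
      have e : br (l * u) z = br (u * l) z + br (br l u) z := by
        simp only [br]; noncomm_ring
      rw [e]
      exact Submodule.add_mem _ (ih u l z h.2)
        (lcs_anti (by omega) (lcs_br' z (by omega) (lcs_br' u hj h.2)))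
    have h0 : ∀ z, br l z ∈ lcs K A (j + 1) := fun z => lcs_br' z hj hl
    have h1 : ∀ u, ∀ z, br (u * l) z ∈ lcs K A (j + 1) := fun u => hL u l ⟨h0, hl⟩
    have h2 : ∀ u, ∀ z, br (l * u) z ∈ lcs K A (j + 1) := fun u => hR u l ⟨h0, hl⟩
    repeat' first
      | with_reducible apply H
      | with_reducible apply Submodule.add_mem
      | with_reducible apply Submodule.sub_mem
    all_goals first
      | exact h0
      | exact h1 _
      | exact h2 _
  rw [Submodule.mem_comap] at h2 ⊢
  simp only [LinearMap.comp_apply, LinearMap.neg_apply, brR_apply, LinearMap.mulLeft_apply] at h2 ⊢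
  rwa [← br_skew] at h2

theorem lcs_odd [CharZero K] (n : ℕ) : ∀ a l x : A, l ∈ lcs K A (2 * n + 1) →
    br (a * l) x ∈ lcs K A (2 * n + 1 + 1) := by
  induction n with
  | zero => intro a l x _; exact lcs_br (a * l) le_rfl (lcs_one x)
  | succ n ih => exact lcs_step (by omega) ih

theorem mIdeal_odd [CharZero K] (n : ℕ) (m x : A) (hm : m ∈ mIdeal K A (2 * n + 1)) :
    br m x ∈ lcs K A (2 * n + 1 + 1) := by
  rw [← brR_apply (K := K), ← Submodule.mem_comap]
  refine (Submodule.span_le.2 ?_ : mIdeal K A (2 * n + 1) ≤ _) hm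
  rintro _ ⟨a, l, b, hl, rfl⟩
  rw [SetLike.mem_coe, Submodule.mem_comap, brR_apply]
  have e : br (a * l * b) x = br ((a * b) * l) x + br (a * br l b) x := by
    simp only [br]; noncomm_ring
  rw [e]
  exact Submodule.add_mem _ (lcs_odd n _ _ _ hl)
    (lcs_odd n _ _ _ (lcs_anti (by omega) (lcs_br' b (by omega) hl)))

theorem mIdeal_lcs [CharZero K] (n k : ℕ) (hk : 1 ≤ k) (m : A) (hm : m ∈ mIdeal K A (2 * n + 1)) :
    ∀ l ∈ lcs K A k, br m l ∈ lcs K A (2 * n + 1 + k) := by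
  induction k, hk using Nat.le_induction with
  | base => intro l _; exact mIdeal_odd n m l hm
  | succ k hk ih =>
    intro l hl
    rw [br_skew, ← brR_apply (K := K)]
    refine Submodule.neg_mem _ ?_
    rw [← Submodule.mem_comap]
    refine lcs_induct hk _ (fun a y hy => ?_) hl
    rw [Submodule.mem_comap, brR_apply]
    have e : br (br a y) m = - br a (br m y) + br y (br m a) := by
      simp only [br]; noncomm_ring
    rw [e]
    refine Submodule.add_mem _ (Submodule.neg_mem _ (lcs_br a (by omega : 1 ≤ 2 * n + 1 + k) (ih y hy))) ?_
    have := lcs_lcs hk (by omega) (mIdeal_odd n m a hm) hy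
    rwa [show 2 * n + 1 + 1 + k = 2 * n + 1 + (k + 1) by ring] at this

end general

/-- In the free associative algebra over a field of characteristic zero, for every odd
`j ≥ 1` and every `k ≥ 1`, one has `[M_j, L_k] ⊆ L_{j+k}`. -/
theorem br_mIdeal_odd_lcs_mem_lcs_add
    (K : Type*) [Field K] [CharZero K] (X : Type*)
    (j k : ℕ) (hj : Odd j) (hj1 : 1 ≤ j) (hk : 1 ≤ k)
    (m : FreeAlgebra K X) (hm : m ∈ mIdeal K (FreeAlgebra K X) j)
    (l : FreeAlgebra K X) (hl : l ∈ lcs K (FreeAlgebra K X) k) :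
    br m l ∈ lcs K (FreeAlgebra K X) (j + k) := by
  obtain ⟨n, rfl⟩ := hj
  exact mIdeal_lcs n k hk m hm l hl
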